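/- Let A_1, …, A_k ∈ S(n,p)* with reduced Cholesky factors N_1, …, N_k ∈ L^{n×p}_*. Then the function M ↦ Σ_{l=1}^k d(M, A_l)² on S(n,p)* attains a unique global minimum (the Fréchet mean), at the point F·Fᵀ ∈ S(n,p)*, where F ∈ L^{n×p}_* is given by F_{ii} = (Π_{l=1}^k (N_l)_{ii})^{1/k} for i = 1,…,p and F_{ij} = (1/k) Σ_{l=1}^k (N_l)_{ij} for i > j. -/

import Mathlib

open Matrix BigOperators

/-- The first `p` columns of the square matrix `M` are linearly independent. -/
def FirstColsIndep (n p : ℕ) (M : Matrix (Fin n) (Fin n) ℝ) : Prop :=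
  LinearIndependent ℝ (fun j : {j : Fin n // (j : ℕ) < p} => (fun i : Fin n => M i j.1))

/-- Membership in `S(n,p)`: real `n×n` positive semidefinite of rank `p`. -/
def MemS (n p : ℕ) (M : Matrix (Fin n) (Fin n) ℝ) : Prop :=
  M.PosSemidef ∧ M.rank = p

/-- Membership in `S(n,p)*`: in `S(n,p)` with first `p` columns linearly independent. -/
def MemSStar (n p : ℕ) (M : Matrix (Fin n) (Fin n) ℝ) : Prop :=
  MemS n p M ∧ FirstColsIndep n p M

/-- `N` is mock lower triangular: `N i j = 0` whenever `i < j`. -/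
def MockLower (n p : ℕ) (N : Matrix (Fin n) (Fin p) ℝ) : Prop :=
  ∀ (i : Fin n) (j : Fin p), (i : ℕ) < (j : ℕ) → N i j = 0

/-- Membership in `L^{n×p}_*`: mock lower triangular with positive mock diagonal. -/
def MemL (n p : ℕ) (N : Matrix (Fin n) (Fin p) ℝ) : Prop :=
  MockLower n p N ∧ ∀ (i : Fin n) (j : Fin p), (i : ℕ) = (j : ℕ) → 0 < N i j

/-- Frobenius norm of a square matrix. -/
noncomputable def frobNorm (n : ℕ) (A : Matrix (Fin n) (Fin n) ℝ) : ℝ :=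
  Real.sqrt (∑ i : Fin n, ∑ j : Fin n, (A i j) ^ 2)

/-- The distance `d̃` on `L^{n×p}_*`. -/
noncomputable def dL (n p : ℕ) (N K : Matrix (Fin n) (Fin p) ℝ) : ℝ :=
  Real.sqrt ((∑ i : Fin n, ∑ j : Fin p, if (j : ℕ) < (i : ℕ) then (N i j - K i j) ^ 2 else 0)
    + ∑ i : Fin n, ∑ j : Fin p, if (i : ℕ) = (j : ℕ)
        then (Real.log (N i j) - Real.log (K i j)) ^ 2 else 0)

/-- The group operation `⊕` on `L^{n×p}_*`. -/
noncomputable def oplus (n p : ℕ) (N K : Matrix (Fin n) (Fin p) ℝ) : Matrix (Fin n) (Fin p) ℝ :=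
  fun i j => if (i : ℕ) = (j : ℕ) then N i j * K i j else N i j + K i j

/-- The identity `I_{n×p}` of `(L^{n×p}_*, ⊕)`. -/
noncomputable def oneL (n p : ℕ) : Matrix (Fin n) (Fin p) ℝ :=
  fun i j => if (i : ℕ) = (j : ℕ) then 1 else 0

/-- The `⊕`-inverse on `L^{n×p}_*`. -/
noncomputable def invL (n p : ℕ) (N : Matrix (Fin n) (Fin p) ℝ) : Matrix (Fin n) (Fin p) ℝ :=
  fun i j => if (i : ℕ) = (j : ℕ) then (N i j)⁻¹ else -(N i j)

/-- The geodesic `γ` of `d̃` joining `N` to `K`. -/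
noncomputable def geo (n p : ℕ) (N K : Matrix (Fin n) (Fin p) ℝ) (t : ℝ) :
    Matrix (Fin n) (Fin p) ℝ :=
  fun i j => if (i : ℕ) = (j : ℕ) then (N i j) ^ (1 - t) * (K i j) ^ t
    else (1 - t) * N i j + t * K i j

/-- The exponential map `Exp_N` on `L^{n×p}_*`. -/
noncomputable def expMap (n p : ℕ) (N X : Matrix (Fin n) (Fin p) ℝ) :
    Matrix (Fin n) (Fin p) ℝ :=
  fun i j => if (i : ℕ) = (j : ℕ) then N i j * Real.exp (X i j / N i j) else N i j + X i j

/-- The logarithm map `Log_N` on `L^{n×p}_*`. -/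
noncomputable def logMap (n p : ℕ) (N K : Matrix (Fin n) (Fin p) ℝ) :
    Matrix (Fin n) (Fin p) ℝ :=
  fun i j => if (i : ℕ) = (j : ℕ) then N i j * (Real.log (K i j) - Real.log (N i j))
    else K i j - N i j

/-- The (unweighted) Fréchet mean candidate of reduced Cholesky factors: geometric mean on
the mock diagonal, arithmetic mean below it. -/
noncomputable def frechetMean (n p k : ℕ) (Nf : Fin k → Matrix (Fin n) (Fin p) ℝ) :
    Matrix (Fin n) (Fin p) ℝ :=
  fun i j => if (i : ℕ) = (j : ℕ) then (∏ l : Fin k, Nf l i j) ^ ((1 : ℝ) / (k : ℝ))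
    else (∑ l : Fin k, Nf l i j) / (k : ℝ)

/-- The Euclidean coordinates on `L^{n×p}_*`: logarithms on the mock diagonal, entries below it. -/
noncomputable def logCoord (n p : ℕ) (N : Matrix (Fin n) (Fin p) ℝ) : Matrix (Fin n) (Fin p) ℝ :=
  fun i j => if (i : ℕ) = (j : ℕ) then Real.log (N i j)
    else if (j : ℕ) < (i : ℕ) then N i j else 0

/-- `d̃` is the Euclidean distance in logarithmic coordinates. -/
theorem dL_sq (n p : ℕ) (N K : Matrix (Fin n) (Fin p) ℝ) :
    dL n p N K ^ 2 = ∑ i, ∑ j, (logCoord n p N i j - logCoord n p K i j) ^ 2 := by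
  rw [dL, Real.sq_sqrt]
  · simp only [← Finset.sum_add_distrib]
    refine Finset.sum_congr rfl fun i _ => Finset.sum_congr rfl fun j _ => ?_
    unfold logCoord
    split_ifs <;> first | omega | simp
  · refine add_nonneg ?_ ?_ <;>
      exact Finset.sum_nonneg fun i _ => Finset.sum_nonneg fun j _ => by
        split_ifs <;> positivity

/-- An element of `L^{n×p}_*` is determined by its logarithmic coordinates. -/
theorem MemL.eq_of_logCoord_eq {n p : ℕ} {N K : Matrix (Fin n) (Fin p) ℝ}
    (hN : MemL n p N) (hK : MemL n p K)
    (h : ∀ i j, logCoord n p N i j = logCoord n p K i j) : N = K := by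
  ext i j
  rcases lt_trichotomy (i : ℕ) (j : ℕ) with hij | hij | hij
  · rw [hN.1 i j hij, hK.1 i j hij]
  · have := h i j
    simp only [logCoord, if_pos hij] at this
    exact Real.log_injOn_pos (hN.2 i j hij) (hK.2 i j hij) this
  · simpa [logCoord, hij, hij.ne'] using h i j

theorem MemL.frechetMean {n p k : ℕ} {Nf : Fin k → Matrix (Fin n) (Fin p) ℝ}
    (hN : ∀ l, MemL n p (Nf l)) : MemL n p (frechetMean n p k Nf) := by
  refine ⟨fun i j hij => ?_, fun i j hij => ?_⟩
  · simp [_root_.frechetMean, hij.ne, fun l => (hN l).1 i j hij]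
  · simp only [_root_.frechetMean, if_pos hij]
    exact Real.rpow_pos_of_pos (Finset.prod_pos fun l _ => (hN l).2 i j hij) _

/-- In logarithmic coordinates `frechetMean` is the arithmetic mean. -/
theorem logCoord_frechetMean {n p k : ℕ} {Nf : Fin k → Matrix (Fin n) (Fin p) ℝ}
    (hN : ∀ l, MemL n p (Nf l)) (i : Fin n) (j : Fin p) :
    logCoord n p (frechetMean n p k Nf) i j = (∑ l, logCoord n p (Nf l) i j) / k := by
  by_cases hij : (i : ℕ) = (j : ℕ)
  · simp only [logCoord, frechetMean, if_pos hij]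
    rw [Real.log_rpow (Finset.prod_pos fun l _ => (hN l).2 i j hij),
      Real.log_prod fun l _ => ((hN l).2 i j hij).ne']
    ring
  · by_cases hji : (j : ℕ) < (i : ℕ) <;> simp [logCoord, frechetMean, hij, hji]

theorem sum_sub_sq_eq_mean {k : ℕ} (hk : 0 < k) (a : Fin k → ℝ) (x : ℝ) :
    ∑ l, (x - a l) ^ 2
      = ∑ l, ((∑ m, a m) / k - a l) ^ 2 + k * (x - (∑ m, a m) / k) ^ 2 := by
  have hk' : (k : ℝ) ≠ 0 := by positivity
  set μ := (∑ m, a m) / k with hμ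
  have hsum : ∑ m, a m = k * μ := by rw [hμ]; field_simp
  have hexp (y : ℝ) : ∑ l, (y - a l) ^ 2 = k * y ^ 2 - 2 * y * (k * μ) + ∑ l, a l ^ 2 := by
    simp only [sub_sq, Finset.sum_add_distrib, Finset.sum_sub_distrib, ← Finset.mul_sum, hsum]
    simp
  rw [hexp, hexp]
  ring

theorem sum_dL_sq_eq {n p k : ℕ} (hk : 0 < k) {Nf : Fin k → Matrix (Fin n) (Fin p) ℝ}
    (hN : ∀ l, MemL n p (Nf l)) (K : Matrix (Fin n) (Fin p) ℝ) :
    ∑ l, dL n p K (Nf l) ^ 2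
      = ∑ l, dL n p (frechetMean n p k Nf) (Nf l) ^ 2
        + k * dL n p K (frechetMean n p k Nf) ^ 2 := by
  have hswap (f : Fin k → Fin n → Fin p → ℝ) :
      ∑ l, ∑ i, ∑ j, f l i j = ∑ i, ∑ j, ∑ l, f l i j := by
    rw [Finset.sum_comm]
    exact Finset.sum_congr rfl fun i _ => Finset.sum_comm
  simp only [dL_sq, hswap, Finset.mul_sum, ← Finset.sum_add_distrib]
  refine Finset.sum_congr rfl fun i _ => Finset.sum_congr rfl fun j _ => ?_
  simp only [logCoord_frechetMean hN]
  exact sum_sub_sq_eq_mean hk _ _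

theorem MemL.eq_of_dL_sq_eq_zero {n p : ℕ} {N K : Matrix (Fin n) (Fin p) ℝ}
    (hN : MemL n p N) (hK : MemL n p K) (h : dL n p N K ^ 2 = 0) : N = K := by
  refine hN.eq_of_logCoord_eq hK fun i j => ?_
  rw [dL_sq, Finset.sum_eq_zero_iff_of_nonneg fun i _ =>
    Finset.sum_nonneg fun j _ => sq_nonneg _] at h
  have hi := h i (Finset.mem_univ _)
  rw [Finset.sum_eq_zero_iff_of_nonneg fun j _ => sq_nonneg _] at hi
  exact sub_eq_zero.mp (pow_eq_zero_iff two_ne_zero |>.mp (hi j (Finset.mem_univ _)))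

/-- The square block formed by the first `p` rows of an element of `L^{n×p}_*` is invertible. -/
theorem MemL.isUnit_submatrix {n p : ℕ} (hpn : p ≤ n) {N : Matrix (Fin n) (Fin p) ℝ}
    (hN : MemL n p N) : IsUnit (N.submatrix (Fin.castLE hpn) id) := by
  rw [Matrix.isUnit_iff_isUnit_det, isUnit_iff_ne_zero, Matrix.det_of_isLowerTriangular]
  · exact Finset.prod_ne_zero_iff.mpr fun i _ => (hN.2 _ _ rfl).ne'
  · intro i j hij
    exact hN.1 _ _ hij

theorem MemL.mulVec_injective {n p : ℕ} (hpn : p ≤ n) {N : Matrix (Fin n) (Fin p) ℝ}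
    (hN : MemL n p N) : Function.Injective N.mulVec := fun v w h =>
  Matrix.mulVec_injective_of_isUnit (hN.isUnit_submatrix hpn) <| by
    ext i
    exact congrFun h (Fin.castLE hpn i)

theorem MemL.memSStar_mul_transpose {n p : ℕ} (hpn : p ≤ n) {N : Matrix (Fin n) (Fin p) ℝ}
    (hN : MemL n p N) : MemSStar n p (N * Nᵀ) := by
  have hinj := hN.mulVec_injective hpn
  refine ⟨⟨by simpa using Matrix.posSemidef_self_mul_conjTranspose N, ?_⟩, ?_⟩
  · rw [Matrix.rank_self_mul_transpose, ← Matrix.rank_transpose]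
    simpa using (Matrix.mulVec_injective_iff.mp hinj).rank_matrix
  · have hrows := Matrix.linearIndependent_rows_of_isUnit (hN.isUnit_submatrix hpn)
    have hmap := hrows.map' N.mulVecLin (LinearMap.ker_eq_bot.mpr hinj)
    exact hmap.comp (fun j : {j : Fin n // (j : ℕ) < p} => (⟨j.1, j.2⟩ : Fin p))
      fun a b hab => Subtype.ext (Fin.ext (Fin.mk.inj_iff.mp hab))

/-- the Fréchet functional `M ↦ Σ_l d(M, A_l)²` on `S(n,p)*` attains a
unique global minimum at `F Fᵀ`, where `F = frechetMean` of the reduced Cholesky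
factors of the `A_l`. -/
theorem stmt16 (n p k : ℕ) (hp : 1 ≤ p) (hpn : p < n) (hk : 0 < k)
    (chol : Matrix (Fin n) (Fin n) ℝ → Matrix (Fin n) (Fin p) ℝ)
    (hchol : ∀ M, MemSStar n p M → MemL n p (chol M) ∧ M = chol M * (chol M)ᵀ)
    (A : Fin k → Matrix (Fin n) (Fin n) ℝ) (hA : ∀ l, MemSStar n p (A l)) :
    MemL n p (frechetMean n p k (fun l => chol (A l))) ∧
    MemSStar n p (frechetMean n p k (fun l => chol (A l))
      * (frechetMean n p k (fun l => chol (A l)))ᵀ) ∧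
    (∀ M, MemSStar n p M →
      ∑ l : Fin k, (dL n p (frechetMean n p k (fun l => chol (A l))) (chol (A l))) ^ 2
        ≤ ∑ l : Fin k, (dL n p (chol M) (chol (A l))) ^ 2) ∧
    (∀ M, MemSStar n p M →
      (∑ l : Fin k, (dL n p (chol M) (chol (A l))) ^ 2
        = ∑ l : Fin k,
            (dL n p (frechetMean n p k (fun l => chol (A l))) (chol (A l))) ^ 2) →
      M = frechetMean n p k (fun l => chol (A l))
        * (frechetMean n p k (fun l => chol (A l)))ᵀ) := by
  have hN : ∀ l, MemL n p (chol (A l)) := fun l => (hchol _ (hA l)).1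
  have hF := MemL.frechetMean hN
  refine ⟨hF, hF.memSStar_mul_transpose hpn.le, fun M _ => ?_, fun M hM h => ?_⟩
  · rw [sum_dL_sq_eq hk hN (chol M)]
    exact le_add_of_nonneg_right (by positivity)
  · rw [sum_dL_sq_eq hk hN (chol M), add_eq_left] at h
    have hzero := (mul_eq_zero.mp h).resolve_left (by positivity)
    rw [← (hchol M hM).1.eq_of_dL_sq_eq_zero hF hzero]
    exact (hchol M hM).2
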